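/- (Weakly memorizing valuation congruence separates wm-basic forms) For all wm-basic forms P and Q, if P =_wm Q then P ≡ Q, i.e., P and Q are syntactically equal. -/

import Mathlib

/-- Propositional statements over atoms `A`: constants `T`, `F`, an atom `a`
for each `a ∈ A`, and the ternary conditional composition
`cond x y z = x ◁ y ▷ z` (with `y` the central condition). -/
inductive PS (A : Type) : Type where
  | tt : PS A
  | ff : PS A
  | atom : A → PS A
  | cond : PS A → PS A → PS A → PS A

/-- A valuation algebra (VA) over `A`. -/
structure VA (A : Type) where
  Val : Type
  Tv : Val
  Fv : Val
  yd : A → Val → Bool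
  dv : A → Val → Val
  yd_T : ∀ a, yd a Tv = true
  yd_F : ∀ a, yd a Fv = false
  dv_T : ∀ a, dv a Tv = Tv
  dv_F : ∀ a, dv a Fv = Fv

variable {A : Type}

mutual
  /-- Evaluation `P/H` of a propositional statement over a valuation `H`. -/
  def PS.eval (V : VA A) : PS A → V.Val → Bool
    | .tt, _ => true
    | .ff, _ => false
    | .atom a, H => V.yd a H
    | .cond p q r, H =>
        if PS.eval V q H then PS.eval V p (PS.deriv V q H)
        else PS.eval V r (PS.deriv V q H)
  /-- The generalized derivative `∂_P(H)`. -/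
  def PS.deriv (V : VA A) : PS A → V.Val → V.Val
    | .tt, H => H
    | .ff, H => H
    | .atom a, H => V.dv a H
    | .cond p q r, H =>
        if PS.eval V q H then PS.deriv V p (PS.deriv V q H)
        else PS.deriv V r (PS.deriv V q H)
end

/-- `K`-equivalence: equal evaluation results in all members of the class `K`. -/
def KEquiv (K : VA A → Prop) (P Q : PS A) : Prop :=
  ∀ V : VA A, K V → ∀ H : V.Val, PS.eval V P H = PS.eval V Q H

/-- A congruence with respect to conditional composition. -/
def IsCondCongruence (R : PS A → PS A → Prop) : Prop :=
  Equivalence R ∧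
    ∀ ⦃x x' y y' z z' : PS A⦄, R x x' → R y y' → R z z' →
      R (PS.cond x y z) (PS.cond x' y' z')

/-- `K`-congruence: the largest congruence contained in `K`-equivalence. -/
def KCong (K : VA A → Prop) (P Q : PS A) : Prop :=
  ∃ R : PS A → PS A → Prop,
    IsCondCongruence R ∧ (∀ x y, R x y → KEquiv K x y) ∧ R P Q

/-- Derivability (of closed equations) in equational logic from the axioms `CP`
together with an additional set `Ax` of equational axioms. -/
inductive Deriv (Ax : PS A → PS A → Prop) : PS A → PS A → Prop where
  | ax {p q} : Ax p q → Deriv Ax p q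
  | cp1 (x y) : Deriv Ax (.cond x .tt y) x
  | cp2 (x y) : Deriv Ax (.cond x .ff y) y
  | cp3 (x) : Deriv Ax (.cond .tt x .ff) x
  | cp4 (x y z u v) :
      Deriv Ax (.cond x (.cond y z u) v)
               (.cond (.cond x y v) z (.cond x u v))
  | refl (x) : Deriv Ax x x
  | symm {p q} : Deriv Ax p q → Deriv Ax q p
  | trans {p q r} : Deriv Ax p q → Deriv Ax q r → Deriv Ax p r
  | congr {x x' y y' z z'} : Deriv Ax x x' → Deriv Ax y y' → Deriv Ax z z' →
      Deriv Ax (.cond x y z) (.cond x' y' z')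

/-- No additional axioms: plain `CP`. -/
def NoAx : PS A → PS A → Prop := fun _ _ => False

/-- The class `fr` of free valuation algebras: all VAs. -/
def frK : VA A → Prop := fun _ => True

/-- The class `rp` of repetition-proof VAs. -/
def rpK (V : VA A) : Prop :=
  ∀ (a : A) (x : V.Val), V.yd a x = V.yd a (V.dv a x)

/-- The class `cr` of contractive VAs. -/
def crK (V : VA A) : Prop :=
  rpK V ∧ ∀ (a : A) (x : V.Val), V.dv a (V.dv a x) = V.dv a x

/-- The class `wm` of weakly memorizing VAs. -/
def wmK (V : VA A) : Prop :=
  crK V ∧ ∀ (a b : A) (x : V.Val),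
    V.yd b (V.dv a x) = V.yd a x →
      V.dv a (V.dv b (V.dv a x)) = V.dv b (V.dv a x) ∧
      V.yd a (V.dv b (V.dv a x)) = V.yd a x

/-- The class `mem` of memorizing VAs. -/
def memK (V : VA A) : Prop :=
  crK V ∧ ∀ (a b : A) (x : V.Val),
    V.dv a (V.dv b (V.dv a x)) = V.dv b (V.dv a x) ∧
    V.yd a (V.dv b (V.dv a x)) = V.yd a x

/-- The class `st` of static VAs. -/
def stK (V : VA A) : Prop :=
  ∀ (a b : A) (x : V.Val), V.yd a (V.dv b x) = V.yd a x

/-- The atoms occurring at left-hand (positive) positions of a basic form: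
`pos(T) = pos(F) = ∅` and `pos(P◁a▷Q) = {a} ∪ pos(P)`. -/
def PS.pos {A : Type} : PS A → Set A
  | .cond p (.atom a) _ => {a} ∪ p.pos
  | _ => ∅

/-- The atoms occurring at right-hand (negative) positions of a basic form:
`neg(T) = neg(F) = ∅` and `neg(P◁a▷Q) = {a} ∪ neg(Q)`. -/
def PS.negs {A : Type} : PS A → Set A
  | .cond _ (.atom a) q => {a} ∪ q.negs
  | _ => ∅

/-- wm-basic forms: `T`, `F`, or `P ◁ a ▷ Q` where `P` and `Q` are wm-basic
forms and `a ∉ pos(P) ∪ neg(Q)`. -/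
inductive WmBasic {A : Type} : PS A → Prop where
  | tt : WmBasic .tt
  | ff : WmBasic .ff
  | cond {p q : PS A} (a : A) :
      WmBasic p → WmBasic q → a ∉ p.pos ∪ q.negs →
      WmBasic (.cond p (.atom a) q)

theorem PS.eval_cond_atom (V : VA A) (p q : PS A) (a : A) (H : V.Val) :
    PS.eval V (.cond p (.atom a) q) H = PS.eval V (bif V.yd a H then p else q) (V.dv a H) := by
  cases h : V.yd a H <;> simp [PS.eval, PS.deriv, h]

theorem PS.deriv_cond_atom (V : VA A) (p q : PS A) (a : A) (H : V.Val) :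
    PS.deriv V (.cond p (.atom a) q) H = PS.deriv V (bif V.yd a H then p else q) (V.dv a H) := by
  cases h : V.yd a H <;> simp [PS.eval, PS.deriv, h]

open Classical in
/-- The valuation algebra of runs: a valuation `(S, f)` consists of an oracle `f`, giving the last
reply `f []` and the reply `f l` after the atoms of a nonempty list `l` have been queried, and the
set `S` of atoms queried since the reply last changed. Atoms in `S` repeat the last reply. -/
noncomputable abbrev runVA (A : Type) : VA A where
  Val := Set A × (List A → Bool)
  Tv := (Set.univ, fun _ => true)
  Fv := (Set.univ, fun _ => false)
  yd a x := if a ∈ x.1 then x.2 [] else x.2 [a]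
  dv a x := if a ∈ x.1 then x else
    (if x.2 [a] = x.2 [] then insert a x.1 else {a}, fun l => x.2 (a :: l))
  yd_T := by simp
  yd_F := by simp
  dv_T := by simp
  dv_F := by simp

namespace runVA

theorem yd_of_mem {a : A} {S : Set A} (f : List A → Bool) (h : a ∈ S) :
    (runVA A).yd a (S, f) = f [] := by
  simp [h]

theorem yd_of_notMem {a : A} {S : Set A} (f : List A → Bool) (h : a ∉ S) :
    (runVA A).yd a (S, f) = f [a] := by
  simp [h]

theorem dv_of_mem {a : A} {S : Set A} (f : List A → Bool) (h : a ∈ S) :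
    (runVA A).dv a (S, f) = (S, f) := by
  simp [runVA, h]

open Classical in
theorem dv_of_notMem {a : A} {S : Set A} (f : List A → Bool) (h : a ∉ S) :
    (runVA A).dv a (S, f) =
      (if f [a] = f [] then insert a S else {a}, fun l => f (a :: l)) := by
  simp [runVA, h]

theorem mem_dv (a : A) (x : (runVA A).Val) : a ∈ ((runVA A).dv a x).1 := by
  obtain ⟨S, f⟩ := x
  by_cases h : a ∈ S
  · rw [dv_of_mem f h]; exact h
  · rw [dv_of_notMem f h]; dsimp only; split <;> simp

theorem last_dv (a : A) (x : (runVA A).Val) :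
    ((runVA A).dv a x).2 [] = (runVA A).yd a x := by
  obtain ⟨S, f⟩ := x
  by_cases h : a ∈ S
  · rw [dv_of_mem f h, yd_of_mem f h]
  · rw [dv_of_notMem f h, yd_of_notMem f h]

theorem mem_dv_of_yd_eq {a b : A} {x : (runVA A).Val} (ha : a ∈ x.1)
    (h : (runVA A).yd b x = x.2 []) : a ∈ ((runVA A).dv b x).1 := by
  obtain ⟨S, f⟩ := x
  by_cases hb : b ∈ S
  · rw [dv_of_mem f hb]; exact ha
  · rw [yd_of_notMem f hb] at h
    rw [dv_of_notMem f hb]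
    dsimp only at h ⊢
    rw [if_pos h]
    exact Set.mem_insert_of_mem _ ha

theorem wm (A : Type) : wmK (runVA A) := by
  refine ⟨⟨fun a x => ?_, fun a x => dv_of_mem _ (mem_dv a x)⟩, fun a b x h => ?_⟩
  · rw [← last_dv]
    exact (yd_of_mem _ (mem_dv a x)).symm
  · have hm := mem_dv_of_yd_eq (mem_dv a x) (h.trans (last_dv a x).symm)
    refine ⟨dv_of_mem _ hm, ?_⟩
    rw [← h, ← last_dv b]
    exact yd_of_mem _ hm

theorem yd_of_const {r : Bool} {x : (runVA A).Val} (h : ∀ l, x.2 l = r) (a : A) :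
    (runVA A).yd a x = r := by
  obtain ⟨S, f⟩ := x
  by_cases ha : a ∈ S
  · rw [yd_of_mem f ha]; exact h _
  · rw [yd_of_notMem f ha]; exact h _

theorem deriv_const {r : Bool} (P : PS A) :
    ∀ {x : (runVA A).Val}, (∀ l, x.2 l = r) → ∀ l, (PS.deriv (runVA A) P x).2 l = r := by
  induction P with
  | tt => intro x h; simpa [PS.deriv] using h
  | ff => intro x h; simpa [PS.deriv] using h
  | atom a =>
    rintro ⟨S, f⟩ h
    rw [PS.deriv]
    by_cases ha : a ∈ S
    · rw [dv_of_mem f ha]; exact h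
    · rw [dv_of_notMem f ha]; exact fun l => h _
  | cond p q s ihp ihq ihs =>
    intro x h
    rw [PS.deriv]
    split
    · exact ihp (ihq h)
    · exact ihs (ihq h)

theorem yd_deriv_cond {a : A} {S : Set A} {f : List A → Bool} {r : Bool} (ha : a ∉ S)
    (h : ∀ l, f (a :: l) = r) (p q : PS A) (b : A) :
    (runVA A).yd b (PS.deriv (runVA A) (.cond p (.atom a) q) (S, f)) = r := by
  have hc : ∀ l, ((runVA A).dv a (S, f)).2 l = r := by
    rw [dv_of_notMem f ha]; exact h
  apply yd_of_const
  rw [PS.deriv_cond_atom]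
  exact deriv_const _ hc

/-- Along the run with reply `r` that queried the atoms of `S`, `P` repeats no query. -/
def Fresh (S : Set A) (r : Bool) (P : PS A) : Prop :=
  ∀ a ∈ S, a ∉ bif r then P.pos else P.negs

theorem Fresh.notMem {S : Set A} {r : Bool} {p q : PS A} {a : A}
    (h : Fresh S r (.cond p (.atom a) q)) : a ∉ S := by
  intro ha
  have := h a ha
  cases r <;> simp [PS.pos, PS.negs] at this

open Classical in
theorem Fresh.branch {S : Set A} {r s : Bool} {p q : PS A} {a : A}
    (h : Fresh S r (.cond p (.atom a) q)) (ha : a ∉ p.pos ∪ q.negs) :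
    Fresh (if s = r then insert a S else {a}) s (bif s then p else q) := by
  intro b hb
  rw [Set.mem_union, not_or] at ha
  split at hb
  · subst s
    rcases hb with rfl | hb
    · cases r
      · exact ha.2
      · exact ha.1
    · have := h b hb
      cases r <;> simp_all [PS.pos, PS.negs]
  · rw [Set.mem_singleton_iff] at hb
    subst hb
    cases s
    · exact ha.2
    · exact ha.1

/-- `P` and `Q` have the same reply and lead to valuations with the same replies, for all oracles
continuing the run with reply `r` that queried the atoms of `S`. -/
def Agree (S : Set A) (r : Bool) (P Q : PS A) : Prop :=
  ∀ f : List A → Bool, f [] = r →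
    PS.eval (runVA A) P (S, f) = PS.eval (runVA A) Q (S, f) ∧
    ∀ a, (runVA A).yd a (PS.deriv (runVA A) P (S, f)) =
      (runVA A).yd a (PS.deriv (runVA A) Q (S, f))

theorem Agree.symm {S : Set A} {r : Bool} {P Q : PS A} (h : Agree S r P Q) : Agree S r Q P :=
  fun f hf => ⟨(h f hf).1.symm, fun a => ((h f hf).2 a).symm⟩

open Classical in
theorem Agree.branch {S : Set A} {r : Bool} {p q p' q' : PS A} {a : A} (ha : a ∉ S)
    (h : Agree S r (.cond p (.atom a) q) (.cond p' (.atom a) q')) (s : Bool) :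
    Agree (if s = r then insert a S else {a}) s (bif s then p else q) (bif s then p' else q') := by
  intro f hf
  let g : List A → Bool := fun l => l.casesOn r fun _ t => f t
  have hy : (runVA A).yd a (S, g) = s := (yd_of_notMem g ha).trans hf
  have hd : (runVA A).dv a (S, g) = (if s = r then insert a S else {a}, f) := by
    rw [dv_of_notMem g ha]
    simp [g, hf]
  refine ⟨?_, fun b => ?_⟩
  · have he := (h g rfl).1
    rwa [PS.eval_cond_atom, PS.eval_cond_atom, hy, hd] at he
  · have he := (h g rfl).2 b
    rwa [PS.deriv_cond_atom, PS.deriv_cond_atom, hy, hd] at he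

theorem not_agree_leaf [Nontrivial A] {S : Set A} {r : Bool} {P p q : PS A} {c : A}
    (hP : ∀ x, PS.deriv (runVA A) P x = x) (hc : c ∉ S) :
    ¬ Agree S r P (.cond p (.atom c) q) := by
  classical
  intro h
  obtain ⟨a, hac⟩ := exists_ne c
  let f : List A → Bool := fun l => l.casesOn r fun b _ => if b = c then !r else r
  have hl : (runVA A).yd a (S, f) = r := by
    by_cases ha : a ∈ S
    · rw [yd_of_mem f ha]
    · rw [yd_of_notMem f ha]; simp [f, hac]
  have := (h f rfl).2 a
  rw [hP, hl, yd_deriv_cond (r := !r) hc (by simp [f])] at this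
  cases r <;> simp at this

theorem not_agree_of_ne {S : Set A} {r : Bool} {p q p' q' : PS A} {a b : A} (ha : a ∉ S)
    (hb : b ∉ S) (hab : b ≠ a) : ¬ Agree S r (.cond p (.atom a) q) (.cond p' (.atom b) q') := by
  classical
  intro h
  let f : List A → Bool := fun l => l.casesOn r fun c _ => decide (c = a)
  have := (h f rfl).2 a
  rw [yd_deriv_cond (r := true) ha (by simp [f]),
    yd_deriv_cond (r := false) hb (by simp [f, hab])] at this
  cases this

theorem eq_of_agree [Nontrivial A] {P : PS A} (hP : WmBasic P) :
    ∀ {Q : PS A}, WmBasic Q → ∀ {S : Set A} {r : Bool}, Fresh S r P → Fresh S r Q →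
      Agree S r P Q → P = Q := by
  induction hP with
  | tt =>
    intro Q hQ S r _ fQ h
    cases hQ with
    | tt => rfl
    | ff => simpa [PS.eval] using (h (fun _ => r) rfl).1
    | cond b => exact (not_agree_leaf (fun _ => by rw [PS.deriv]) fQ.notMem h).elim
  | ff =>
    intro Q hQ S r _ fQ h
    cases hQ with
    | tt => simpa [PS.eval] using (h (fun _ => r) rfl).1
    | ff => rfl
    | cond b => exact (not_agree_leaf (fun _ => by rw [PS.deriv]) fQ.notMem h).elim
  | @cond p q a _ _ ha ihp ihq =>
    intro Q hQ S r fP fQ h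
    cases hQ with
    | tt => exact (not_agree_leaf (fun _ => by rw [PS.deriv]) fP.notMem h.symm).elim
    | ff => exact (not_agree_leaf (fun _ => by rw [PS.deriv]) fP.notMem h.symm).elim
    | @cond p' q' b hp' hq' hb =>
      by_cases hab : b = a
      · subst hab
        have h₁ : p = p' := ihp hp' (fP.branch (s := true) ha) (fQ.branch (s := true) hb)
          (h.branch fP.notMem true)
        have h₂ : q = q' := ihq hq' (fP.branch (s := false) ha) (fQ.branch (s := false) hb)
          (h.branch fP.notMem false)
        rw [h₁, h₂]
      · exact (not_agree_of_ne fP.notMem fQ.notMem hab h).elim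

end runVA

/-- `K`-congruent statements lead to valuations with the same replies. -/
theorem KCong.yd_deriv_eq {K : VA A → Prop} {P Q : PS A} (h : KCong K P Q) {V : VA A} (hV : K V)
    (H : V.Val) (a : A) : V.yd a (PS.deriv V P H) = V.yd a (PS.deriv V Q H) := by
  obtain ⟨R, ⟨hR, hc⟩, hK, hPQ⟩ := h
  have := hK _ _ (hc (hR.refl (.atom a)) hPQ (hR.refl (.atom a))) V hV H
  simpa [PS.eval] using this

/-- **Weakly memorizing valuation congruence separates wm-basic forms**: if
wm-basic forms `P` and `Q` satisfy `P =_wm Q`, then they are syntactically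
equal. -/
theorem wm_congruence_separates_wm_basic_forms {A : Type} [Countable A]
    [Nontrivial A] (P Q : PS A) (hP : WmBasic P) (hQ : WmBasic Q)
    (h : KCong wmK P Q) : P = Q := by
  refine runVA.eq_of_agree hP hQ (S := ∅) (r := true) (by simp [runVA.Fresh])
    (by simp [runVA.Fresh]) fun f _ => ⟨?_, h.yd_deriv_eq (runVA.wm A) _⟩
  obtain ⟨R, _, hK, hPQ⟩ := h
  exact hK _ _ hPQ _ (runVA.wm A) _
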